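/- Let r ≥ 1 be an integer, a = (a_1,…,a_r) ∈ [0,1]^r, 0 ≤ k ≤ r, and N ∈ ℕ. Set C := 1 + 2∑_{j=1}^{r} (1−a_j)² and let c be a real number with 0 < c ≤ C and c ≤ M_r^{(a)}(x) for all x ∈ [−1,1]. Then for any univariate real polynomial Q such that Q(x) = ∫_{−1}^{1} T_k(y)·S_r^{(a)}(x,y)² dμ(y) for all x ∈ ℝ, one has ‖p_{r,N}^{(a)}·Q − T_k‖_{1,cheb} ≤ ((N+1)/C)·‖Q − M_r^{(a)}·T_k‖_{1,cheb} + (C/c)·√(2((N+2)r+1))·(1 − c/C)^{N+1}. -/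

import Mathlib

open Polynomial MeasureTheory

/-- The k-th Chebyshev polynomial of the first kind over ℝ. -/
noncomputable def chebT (k : ℕ) : Polynomial ℝ := Polynomial.Chebyshev.T ℝ (k : ℤ)

/-- The Chebyshev 1-norm of a univariate real polynomial: the sum of the absolute
values of the coefficients in the (unique) expansion in the Chebyshev basis. -/
noncomputable def cheb1Norm (p : Polynomial ℝ) : ℝ :=
  sInf {s : ℝ | ∃ c : ℕ →₀ ℝ,
    p = c.sum (fun j coef => Polynomial.C coef * chebT j) ∧ s = c.sum (fun _ coef => |coef|)}

/-- The Chebyshev probability measure on `[-1,1]`, `dμ(y) = dy/(π √(1-y²))`. -/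
noncomputable def chebMeasure : Measure ℝ :=
  (volume.restrict (Set.Icc (-1 : ℝ) 1)).withDensity
    (fun y => ENNReal.ofReal (1 / (Real.pi * Real.sqrt (1 - y ^ 2))))

/-- The kernel `S_r^{(a)}(x,y) = 1 + 2∑_{j=1}^r (1-a_j) T_j(x) T_j(y)`. -/
noncomputable def Sker (r : ℕ) (a : ℕ → ℝ) (x y : ℝ) : ℝ :=
  1 + 2 * ∑ j ∈ Finset.Icc 1 r, (1 - a j) * (chebT j).eval x * (chebT j).eval y

/-- `M_r^{(a)}` as a polynomial, `M_r^{(a)} = 1 + 2∑_{j=1}^r (1-a_j)² T_j²`. -/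
noncomputable def MPoly (r : ℕ) (a : ℕ → ℝ) : Polynomial ℝ :=
  1 + Polynomial.C 2 * ∑ j ∈ Finset.Icc 1 r, Polynomial.C ((1 - a j) ^ 2) * (chebT j) ^ 2

/-- `C = 1 + 2∑_{j=1}^r (1-a_j)²`. -/
noncomputable def Cval (r : ℕ) (a : ℕ → ℝ) : ℝ := 1 + 2 * ∑ j ∈ Finset.Icc 1 r, (1 - a j) ^ 2

/-- The polynomial `p_{r,N}^{(a)} = (1/C) ∑_{m=0}^{N} (1 - M_r^{(a)}/C)^m`. -/
noncomputable def pPoly (r : ℕ) (a : ℕ → ℝ) (N : ℕ) : Polynomial ℝ :=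
  Polynomial.C (1 / Cval r a) *
    ∑ m ∈ Finset.range (N + 1), ((1 : Polynomial ℝ) - Polynomial.C (1 / Cval r a) * MPoly r a) ^ m

open Polynomial.Chebyshev in
/-- The basis of `ℝ[X]` formed by the Chebyshev polynomials. -/
noncomputable def chebBasis : Module.Basis ℕ ℝ ℝ[X] :=
  (chebyshevTsequence ℝ).basis fun i => by
    rw [isUnit_iff_ne_zero, leadingCoeff_ne_zero]
    exact (chebyshevTsequence ℝ).ne_zero i

lemma chebBasis_apply (j : ℕ) : chebBasis j = chebT j :=
  Polynomial.Sequence.basis_eq_self _ _ _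

lemma finsuppSum_C_mul_chebT (c : ℕ →₀ ℝ) :
    c.sum (fun j coef => C coef * chebT j) = chebBasis.repr.symm c := by
  rw [chebBasis.repr_symm_apply, Finsupp.linearCombination_apply]
  simp only [chebBasis_apply, smul_eq_C_mul]

lemma cheb1Norm_eq_sum (p : ℝ[X]) :
    cheb1Norm p = (chebBasis.repr p).sum fun _ coef => |coef| := by
  have h : {s : ℝ | ∃ c : ℕ →₀ ℝ, p = c.sum (fun j coef => C coef * chebT j) ∧
      s = c.sum (fun _ coef => |coef|)} = {(chebBasis.repr p).sum fun _ coef => |coef|} := by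
    ext s
    simp only [finsuppSum_C_mul_chebT, Set.mem_ofPred_eq, Set.mem_singleton_iff]
    constructor
    · rintro ⟨c, rfl, rfl⟩
      simp
    · rintro rfl
      exact ⟨chebBasis.repr p, by simp, rfl⟩
  rw [cheb1Norm, h, csInf_singleton]

lemma eq_sum_C_mul_chebT (p : ℝ[X]) :
    p = ∑ j ∈ (chebBasis.repr p).support, C (chebBasis.repr p j) * chebT j := by
  have h := finsuppSum_C_mul_chebT (chebBasis.repr p)
  rw [LinearEquiv.symm_apply_apply] at h
  exact h.symm

lemma cheb1Norm_nonneg (p : ℝ[X]) : 0 ≤ cheb1Norm p := by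
  rw [cheb1Norm_eq_sum]
  exact Finset.sum_nonneg fun _ _ => abs_nonneg _

lemma cheb1Norm_zero : cheb1Norm 0 = 0 := by
  simp [cheb1Norm_eq_sum]

lemma cheb1Norm_chebT (k : ℕ) : cheb1Norm (chebT k) = 1 := by
  rw [cheb1Norm_eq_sum, ← chebBasis_apply, Module.Basis.repr_self]
  simp

lemma cheb1Norm_add_le (p q : ℝ[X]) : cheb1Norm (p + q) ≤ cheb1Norm p + cheb1Norm q := by
  classical
  simp only [cheb1Norm_eq_sum, map_add]
  set c := chebBasis.repr p
  set d := chebBasis.repr q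
  rw [Finsupp.sum_of_support_subset (c + d) Finsupp.support_add _ (by simp),
    Finsupp.sum_of_support_subset c (Finset.subset_union_left (s₂ := d.support)) _ (by simp),
    Finsupp.sum_of_support_subset d (Finset.subset_union_right (s₁ := c.support)) _ (by simp),
    ← Finset.sum_add_distrib]
  exact Finset.sum_le_sum fun j _ => abs_add_le _ _

lemma cheb1Norm_C_mul (t : ℝ) (p : ℝ[X]) : cheb1Norm (C t * p) = |t| * cheb1Norm p := by
  rw [← smul_eq_C_mul, cheb1Norm_eq_sum, cheb1Norm_eq_sum, map_smul,
    Finsupp.sum_of_support_subset (t • chebBasis.repr p) Finsupp.support_smul _ (by simp),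
    Finsupp.sum, Finset.mul_sum]
  simp [abs_mul]

lemma cheb1Norm_neg (p : ℝ[X]) : cheb1Norm (-p) = cheb1Norm p := by
  simpa using cheb1Norm_C_mul (-1) p

lemma cheb1Norm_sum_le {ι : Type*} (s : Finset ι) (f : ι → ℝ[X]) :
    cheb1Norm (∑ i ∈ s, f i) ≤ ∑ i ∈ s, cheb1Norm (f i) :=
  Finset.le_sum_of_subadditive _ cheb1Norm_zero.le cheb1Norm_add_le _ _

lemma chebT_mul_chebT (m k : ℕ) : ∃ l, 2 * chebT m * chebT k = chebT (m + k) + chebT l := by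
  refine ⟨((m : ℤ) - k).natAbs, ?_⟩
  rw [chebT, chebT, Chebyshev.T_mul_T, chebT, chebT, Chebyshev.T_natAbs]
  push_cast
  rfl

lemma cheb1Norm_chebT_mul_chebT_le (m k : ℕ) : cheb1Norm (chebT m * chebT k) ≤ 1 := by
  obtain ⟨l, hl⟩ := chebT_mul_chebT m k
  have h1 : cheb1Norm (C 2 * (chebT m * chebT k)) ≤ 1 + 1 := by
    rw [show C (2 : ℝ) * (chebT m * chebT k) = chebT (m + k) + chebT l by
      rw [← hl, mul_assoc]; rfl]
    simpa only [cheb1Norm_chebT] using cheb1Norm_add_le (chebT (m + k)) (chebT l)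
  rw [cheb1Norm_C_mul, abs_of_pos two_pos] at h1
  linarith

lemma cheb1Norm_mul_le (p q : ℝ[X]) : cheb1Norm (p * q) ≤ cheb1Norm p * cheb1Norm q := by
  conv_lhs => rw [eq_sum_C_mul_chebT p, eq_sum_C_mul_chebT q, Finset.sum_mul_sum]
  rw [cheb1Norm_eq_sum p, cheb1Norm_eq_sum q, Finsupp.sum, Finsupp.sum, Finset.sum_mul_sum]
  refine (cheb1Norm_sum_le _ _).trans (Finset.sum_le_sum fun i _ => ?_)
  refine (cheb1Norm_sum_le _ _).trans (Finset.sum_le_sum fun j _ => ?_)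
  rw [mul_mul_mul_comm, ← C_mul, cheb1Norm_C_mul, abs_mul]
  exact mul_le_of_le_one_right (by positivity) (cheb1Norm_chebT_mul_chebT_le i j)

lemma cheb1Norm_one : cheb1Norm 1 = 1 := by
  simpa [chebT] using cheb1Norm_chebT 0

lemma cheb1Norm_pow_le (p : ℝ[X]) (m : ℕ) : cheb1Norm (p ^ m) ≤ cheb1Norm p ^ m := by
  induction m with
  | zero => simp [cheb1Norm_one]
  | succ m ih =>
    rw [pow_succ, pow_succ]
    exact (cheb1Norm_mul_le _ _).trans (mul_le_mul_of_nonneg_right ih (cheb1Norm_nonneg _))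

lemma chebT_comp_chebT (m k : ℕ) : (chebT m).comp (chebT k) = chebT (m * k) := by
  rw [chebT, chebT, chebT, ← Chebyshev.T_mul]
  push_cast
  rfl

lemma cheb1Norm_comp_chebT_le (p : ℝ[X]) (k : ℕ) :
    cheb1Norm (p.comp (chebT k)) ≤ cheb1Norm p := by
  conv_lhs => rw [eq_sum_C_mul_chebT p, Polynomial.sum_comp]
  rw [cheb1Norm_eq_sum p, Finsupp.sum]
  refine (cheb1Norm_sum_le _ _).trans (Finset.sum_le_sum fun j _ => ?_)
  rw [mul_comp, C_comp, chebT_comp_chebT, cheb1Norm_C_mul, cheb1Norm_chebT, mul_one]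

lemma chebBasis_repr_support_subset {p : ℝ[X]} {n : ℕ} (hp : p.natDegree ≤ n) :
    (chebBasis.repr p).support ⊆ Finset.range (n + 1) := by
  have hmem : p ∈ Submodule.span ℝ (chebBasis '' Set.Iic n) := by
    have h := (Chebyshev.chebyshevTsequence ℝ).span_degreeLE (m := n) fun i _ => by
      rw [isUnit_iff_ne_zero, leadingCoeff_ne_zero]
      exact (Chebyshev.chebyshevTsequence ℝ).ne_zero i
    rw [show ⇑chebBasis = Chebyshev.chebyshevTsequence ℝ from
      funext fun j => Polynomial.Sequence.basis_eq_self _ _ _, h, mem_degreeLE]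
    exact natDegree_le_iff_degree_le.mp hp
  intro j hj
  have := chebBasis.mem_span_image.mp hmem hj
  simpa [Nat.lt_succ_iff] using this

lemma abs_eval_chebT_le_one (j : ℕ) {x : ℝ} (hx : x ∈ Set.Icc (-1 : ℝ) 1) :
    |(chebT j).eval x| ≤ 1 :=
  Chebyshev.abs_eval_T_real_le_one _ (abs_le.mpr hx)

lemma integral_eval_mul_eval_chebT (p : ℝ[X]) (j : ℕ) :
    ∫ x, p.eval x * (chebT j).eval x ∂Chebyshev.measureT =
      chebBasis.repr p j * ∫ x, (chebT j).eval x * (chebT j).eval x ∂Chebyshev.measureT := by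
  conv_lhs => rw [eq_sum_C_mul_chebT p]
  simp only [eval_finsetSum, Finset.sum_mul, eval_mul, eval_C, mul_assoc]
  rw [integral_finsetSum _ fun i _ => Chebyshev.integrable_measureT (by fun_prop)]
  simp only [integral_const_mul]
  rw [Finset.sum_eq_single j]
  · intro i _ hij
    rw [chebT, chebT, Chebyshev.integral_eval_T_real_mul_eval_T_real_measureT_of_ne hij, mul_zero]
  · intro hj
    rw [Finsupp.notMem_support_iff.mp hj, zero_mul]

lemma pi_div_two_le_integral_eval_chebT_mul_self (j : ℕ) :
    Real.pi / 2 ≤ ∫ x, (chebT j).eval x * (chebT j).eval x ∂Chebyshev.measureT := by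
  rcases eq_or_ne j 0 with rfl | hj
  · have h := Chebyshev.integral_eval_T_real_mul_self_measureT_zero
    simp only [chebT, Nat.cast_zero, h]
    linarith [Real.pi_pos]
  · exact (Chebyshev.integral_T_real_mul_self_measureT_of_ne_zero hj).ge

/-- A Bessel-type bound on the Chebyshev coefficients. -/
lemma sum_sq_chebBasis_repr_le {p : ℝ[X]} {B : ℝ}
    (hB : ∀ x ∈ Set.Icc (-1 : ℝ) 1, |p.eval x| ≤ B) :
    ∑ j ∈ (chebBasis.repr p).support, chebBasis.repr p j ^ 2 ≤ 2 * B ^ 2 := by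
  have hupper : ∫ x, p.eval x * p.eval x ∂Chebyshev.measureT ≤ Real.pi * B ^ 2 := by
    rw [Chebyshev.integral_measureT_eq_integral_cos]
    have hle : ∀ θ : ℝ, p.eval (Real.cos θ) * p.eval (Real.cos θ) ≤ B ^ 2 := fun θ => by
      rw [← sq, ← sq_abs]
      exact pow_le_pow_left₀ (abs_nonneg _) (hB _ (Real.cos_mem_Icc θ)) 2
    calc _ ≤ ∫ _θ in (0 : ℝ)..Real.pi, B ^ 2 :=
          intervalIntegral.integral_mono Real.pi_pos.le
            (Continuous.intervalIntegrable (by fun_prop) _ _) (by simp) hle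
      _ = _ := by simp
  have hlower : Real.pi / 2 * ∑ j ∈ (chebBasis.repr p).support, chebBasis.repr p j ^ 2 ≤
      ∫ x, p.eval x * p.eval x ∂Chebyshev.measureT := by
    have hexp : ∀ x, p.eval x * p.eval x =
        ∑ j ∈ (chebBasis.repr p).support,
          chebBasis.repr p j * (p.eval x * (chebT j).eval x) := fun x => by
      conv_lhs => rw [eq_sum_C_mul_chebT p]
      conv_lhs => arg 2; rw [eval_finsetSum]
      rw [← eq_sum_C_mul_chebT p, Finset.mul_sum]
      refine Finset.sum_congr rfl fun j _ => ?_
      rw [eval_mul, eval_C]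
      ring
    simp only [hexp]
    rw [integral_finsetSum _ fun i _ => Chebyshev.integrable_measureT (by fun_prop),
      Finset.mul_sum]
    refine Finset.sum_le_sum fun j _ => ?_
    rw [integral_const_mul, integral_eval_mul_eval_chebT, ← mul_assoc, ← sq, mul_comm]
    exact mul_le_mul_of_nonneg_left (pi_div_two_le_integral_eval_chebT_mul_self j) (sq_nonneg _)
  have h := hlower.trans hupper
  nlinarith [Real.pi_pos]

lemma cheb1Norm_le_sqrt_mul {p : ℝ[X]} {n : ℕ} {B : ℝ} (hp : p.natDegree ≤ n)
    (hB : ∀ x ∈ Set.Icc (-1 : ℝ) 1, |p.eval x| ≤ B) :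
    cheb1Norm p ≤ √(2 * (n + 1)) * B := by
  have hB0 : 0 ≤ B := (abs_nonneg _).trans (hB 0 (by simp))
  have hcard : ((chebBasis.repr p).support.card : ℝ) ≤ n + 1 := by
    have := Finset.card_le_card (chebBasis_repr_support_subset hp)
    rw [Finset.card_range] at this
    exact_mod_cast this
  have hsq : cheb1Norm p ^ 2 ≤ (2 * (n + 1)) * B ^ 2 := by
    rw [cheb1Norm_eq_sum, Finsupp.sum]
    calc _ ≤ ((chebBasis.repr p).support.card : ℝ) *
          ∑ j ∈ (chebBasis.repr p).support, |chebBasis.repr p j| ^ 2 :=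
          sq_sum_le_card_mul_sum_sq
      _ ≤ (n + 1) * (2 * B ^ 2) := by
          simp only [sq_abs]
          exact mul_le_mul hcard (sum_sq_chebBasis_repr_le hB)
            (Finset.sum_nonneg fun _ _ => sq_nonneg _) (by positivity)
      _ = _ := by ring
  rw [← Real.sqrt_sq hB0, ← Real.sqrt_mul (by positivity)]
  exact Real.le_sqrt_of_sq_le hsq

lemma one_le_Cval (r : ℕ) (a : ℕ → ℝ) : 1 ≤ Cval r a := by
  have : 0 ≤ ∑ j ∈ Finset.Icc 1 r, (1 - a j) ^ 2 := Finset.sum_nonneg fun _ _ => sq_nonneg _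
  rw [Cval]
  linarith

lemma MPoly_eval_le_Cval (r : ℕ) (a : ℕ → ℝ) {x : ℝ} (hx : x ∈ Set.Icc (-1 : ℝ) 1) :
    (MPoly r a).eval x ≤ Cval r a := by
  simp only [MPoly, Cval, eval_add, eval_one, eval_mul, eval_C, eval_finsetSum, eval_pow]
  gcongr with j
  refine mul_le_of_le_one_right (sq_nonneg _) ?_
  exact (sq_le_one_iff_abs_le_one _).mpr (abs_eval_chebT_le_one j hx)

/-- The polynomial `q` with `q(2x² - 1) = 1 - M(x)/C`. -/
noncomputable def defectPoly (r : ℕ) (a : ℕ → ℝ) : ℝ[X] :=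
  C (1 / Cval r a) * ∑ j ∈ Finset.Icc 1 r, C ((1 - a j) ^ 2) * (1 - chebT j)

lemma defectPoly_comp_chebT_two (r : ℕ) (a : ℕ → ℝ) :
    (defectPoly r a).comp (chebT 2) = 1 - C (1 / Cval r a) * MPoly r a := by
  have hC : Cval r a ≠ 0 := (zero_lt_one.trans_le (one_le_Cval r a)).ne'
  have h1 : (1 : ℝ[X]) = C (1 / Cval r a) * C (Cval r a) := by
    rw [← C_mul, one_div_mul_cancel hC, C_1]
  have hsq : ∀ j, 2 * chebT j ^ 2 = chebT (j * 2) + 1 := fun j => by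
    have h := Chebyshev.T_mul_T ℝ j j
    rw [sub_self, Chebyshev.T_zero, ← mul_two] at h
    rw [chebT, chebT, sq, ← mul_assoc, h]
    push_cast
    rfl
  conv_rhs => lhs; rw [h1]
  rw [defectPoly, mul_comp, C_comp, ← mul_sub, Polynomial.sum_comp]
  congr 1
  rw [MPoly, Cval]
  simp only [mul_comp, C_comp, sub_comp, one_comp, chebT_comp_chebT, map_add, map_mul, map_sum,
    map_one]
  rw [add_sub_add_left_eq_sub, ← mul_sub, ← Finset.sum_sub_distrib, Finset.mul_sum]
  refine Finset.sum_congr rfl fun j _ => ?_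
  have h2 : (C 2 : ℝ[X]) = 2 := rfl
  rw [h2]
  linear_combination C ((1 - a j) ^ 2) * hsq j

lemma natDegree_defectPoly_le (r : ℕ) (a : ℕ → ℝ) : (defectPoly r a).natDegree ≤ r := by
  refine (natDegree_C_mul_le _ _).trans (natDegree_sum_le_of_forall_le _ _ fun j hj => ?_)
  refine (natDegree_C_mul_le _ _).trans ((natDegree_sub_le _ _).trans ?_)
  rw [chebT, Chebyshev.natDegree_T]
  simpa using (Finset.mem_Icc.mp hj).2

lemma cheb1Norm_defectPoly_le_one (r : ℕ) (a : ℕ → ℝ) : cheb1Norm (defectPoly r a) ≤ 1 := by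
  have hC : 0 < Cval r a := zero_lt_one.trans_le (one_le_Cval r a)
  have hterm : ∀ j, cheb1Norm (C ((1 - a j) ^ 2) * (1 - chebT j)) ≤ (1 - a j) ^ 2 * 2 := by
    intro j
    rw [cheb1Norm_C_mul, abs_of_nonneg (sq_nonneg _), sub_eq_add_neg]
    refine mul_le_mul_of_nonneg_left ((cheb1Norm_add_le _ _).trans ?_) (sq_nonneg _)
    rw [cheb1Norm_neg, cheb1Norm_one, cheb1Norm_chebT]
    norm_num
  have hsum := (cheb1Norm_sum_le (Finset.Icc 1 r) fun j =>
    C ((1 - a j) ^ 2) * (1 - chebT j)).trans (Finset.sum_le_sum fun j _ => hterm j)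
  rw [← Finset.sum_mul] at hsum
  rw [defectPoly, cheb1Norm_C_mul, abs_of_pos (by positivity), one_div, inv_mul_le_one₀ hC]
  rw [Cval]
  linarith

lemma abs_eval_defectPoly_le {r : ℕ} {a : ℕ → ℝ} {c : ℝ}
    (hcM : ∀ x ∈ Set.Icc (-1 : ℝ) 1, c ≤ (MPoly r a).eval x) {x : ℝ}
    (hx : x ∈ Set.Icc (-1 : ℝ) 1) : |(defectPoly r a).eval x| ≤ 1 - c / Cval r a := by
  have hC : 0 < Cval r a := zero_lt_one.trans_le (one_le_Cval r a)
  have hx0 : 0 ≤ (1 + x) / 2 := by linarith [hx.1]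
  have hy : √((1 + x) / 2) ∈ Set.Icc (-1 : ℝ) 1 :=
    ⟨by linarith [Real.sqrt_nonneg ((1 + x) / 2)], Real.sqrt_le_one.mpr (by linarith [hx.2])⟩
  have hT : (chebT 2).eval √((1 + x) / 2) = x := by
    have h2 : chebT 2 = 2 * X ^ 2 - 1 := Chebyshev.T_two ℝ
    simp only [h2, eval_sub, eval_mul, eval_pow, eval_X, eval_one, eval_ofNat, Real.sq_sqrt hx0]
    ring
  have heval : (defectPoly r a).eval x =
      1 - (MPoly r a).eval √((1 + x) / 2) / Cval r a := by
    have h := congrArg (eval √((1 + x) / 2)) (defectPoly_comp_chebT_two r a)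
    rw [eval_comp, hT] at h
    rw [h]
    simp only [eval_sub, eval_one, eval_mul, eval_C]
    ring
  have hle := (div_le_one hC).mpr (MPoly_eval_le_Cval r a hy)
  have hge := div_le_div_of_nonneg_right (hcM _ hy) hC.le
  rw [heval, abs_of_nonneg (by linarith)]
  linarith

lemma cheb1Norm_one_sub_MPoly_le_one (r : ℕ) (a : ℕ → ℝ) :
    cheb1Norm (1 - C (1 / Cval r a) * MPoly r a) ≤ 1 := by
  rw [← defectPoly_comp_chebT_two]
  exact (cheb1Norm_comp_chebT_le _ _).trans (cheb1Norm_defectPoly_le_one r a)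

lemma cheb1Norm_one_sub_MPoly_pow_le {r : ℕ} {a : ℕ → ℝ} {c : ℝ}
    (hcM : ∀ x ∈ Set.Icc (-1 : ℝ) 1, c ≤ (MPoly r a).eval x) (m : ℕ) :
    cheb1Norm ((1 - C (1 / Cval r a) * MPoly r a) ^ m) ≤
      √(2 * ((m * r : ℕ) + 1)) * (1 - c / Cval r a) ^ m := by
  rw [← defectPoly_comp_chebT_two, ← pow_comp]
  refine (cheb1Norm_comp_chebT_le _ _).trans (cheb1Norm_le_sqrt_mul ?_ fun x hx => ?_)
  · exact natDegree_pow_le_of_le m (natDegree_defectPoly_le r a)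
  · rw [eval_pow, abs_pow]
    exact pow_le_pow_left₀ (abs_nonneg _) (abs_eval_defectPoly_le hcM hx) m

lemma cheb1Norm_pPoly_le (r : ℕ) (a : ℕ → ℝ) (N : ℕ) :
    cheb1Norm (pPoly r a N) ≤ ((N : ℝ) + 1) / Cval r a := by
  have hC : 0 < Cval r a := zero_lt_one.trans_le (one_le_Cval r a)
  have hsum : cheb1Norm (∑ m ∈ Finset.range (N + 1),
      ((1 : ℝ[X]) - C (1 / Cval r a) * MPoly r a) ^ m) ≤ (N : ℝ) + 1 := by
    refine (cheb1Norm_sum_le _ _).trans ((Finset.sum_le_card_nsmul _ _ 1 fun m _ => ?_).trans ?_)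
    · exact (cheb1Norm_pow_le _ m).trans
        (pow_le_one₀ (cheb1Norm_nonneg _) (cheb1Norm_one_sub_MPoly_le_one r a))
    · simp
  rw [pPoly, cheb1Norm_C_mul, abs_of_pos (by positivity), one_div_mul_eq_div]
  exact div_le_div_of_nonneg_right hsum hC.le

lemma pPoly_mul_MPoly (r : ℕ) (a : ℕ → ℝ) (N : ℕ) :
    pPoly r a N * MPoly r a = 1 - (1 - C (1 / Cval r a) * MPoly r a) ^ (N + 1) := by
  have h := mul_neg_geom_sum ((1 : ℝ[X]) - C (1 / Cval r a) * MPoly r a) (N + 1)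
  rw [← h, pPoly]
  ring

/-- error bound for `p_{r,N}^{(a)} · K_r^{(a)}(T_k)` against `T_k` in the
Chebyshev 1-norm. -/
theorem cheb1Norm_pPoly_error_bound (r : ℕ) (hr : 1 ≤ r) (a : ℕ → ℝ) (ha0 : a 0 = 0)
    (ha : ∀ j ∈ Finset.Icc 1 r, a j ∈ Set.Icc (0 : ℝ) 1) (ha1 : ∀ m, r < m → a m = 1)
    (k : ℕ) (hk : k ≤ r) (N : ℕ) (c : ℝ) (hc : 0 < c) (hcC : c ≤ Cval r a)
    (hcM : ∀ x ∈ Set.Icc (-1 : ℝ) 1, c ≤ (MPoly r a).eval x)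
    (Q : Polynomial ℝ)
    (hQ : ∀ x : ℝ, Q.eval x = ∫ y, (chebT k).eval y * (Sker r a x y) ^ 2 ∂chebMeasure) :
    cheb1Norm (pPoly r a N * Q - chebT k) ≤
      (((N : ℝ) + 1) / Cval r a) * cheb1Norm (Q - MPoly r a * chebT k) +
      (Cval r a / c) * Real.sqrt (2 * (((N : ℝ) + 2) * r + 1)) * (1 - c / Cval r a) ^ (N + 1) := by
  have hC : 0 < Cval r a := zero_lt_one.trans_le (one_le_Cval r a)
  have hsplit : pPoly r a N * Q - chebT k = pPoly r a N * (Q - MPoly r a * chebT k) +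
      -((1 - C (1 / Cval r a) * MPoly r a) ^ (N + 1) * chebT k) := by
    linear_combination chebT k * pPoly_mul_MPoly r a N
  have hratio : 0 ≤ 1 - c / Cval r a := sub_nonneg.mpr ((div_le_one hC).mpr hcC)
  rw [hsplit]
  refine (cheb1Norm_add_le _ _).trans (add_le_add ?_ ?_)
  · exact (cheb1Norm_mul_le _ _).trans
      (mul_le_mul_of_nonneg_right (cheb1Norm_pPoly_le r a N) (cheb1Norm_nonneg _))
  · rw [cheb1Norm_neg]
    refine (cheb1Norm_mul_le _ _).trans ?_
    rw [cheb1Norm_chebT, mul_one]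
    refine (cheb1Norm_one_sub_MPoly_pow_le hcM (N + 1)).trans
      (mul_le_mul_of_nonneg_right ?_ (pow_nonneg hratio _))
    refine le_trans ?_ (le_mul_of_one_le_left (Real.sqrt_nonneg _) ((one_le_div hc).mpr hcC))
    refine Real.sqrt_le_sqrt ?_
    push_cast
    have : (0 : ℝ) ≤ r := r.cast_nonneg
    linarith
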